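/- The bilinear form (E_G, FC_b(C_0(ℝ^d),Γ)) is closable on L²(Γ,μ): for every sequence (F_n) in FC_b(C_0(ℝ^d),Γ) such that F_n → 0 in L²(Γ,μ) and E_G(F_n − F_m, F_n − F_m) → 0 as n,m → ∞, one has E_G(F_n, F_n) → 0 as n → ∞. -/

import Mathlib

open MeasureTheory Set Filter
open scoped ENNReal NNReal BigOperators Topology Classical

noncomputable section

abbrev EucSp (d : ℕ) := EuclideanSpace ℝ (Fin d)

/-- The configuration space `Γ` over `ℝ^d`: locally finite subsets. -/
def Config (d : ℕ) : Type :=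
  {γ : Set (EucSp d) // ∀ Λ : Set (EucSp d), IsCompact Λ → (γ ∩ Λ).Finite}

/-- The σ-algebra on `Γ` generated by the maps `γ ↦ |γ ∩ B|`, `B` Borel. -/
instance Config.instMS (d : ℕ) : MeasurableSpace (Config d) :=
  ⨆ (B : Set (EucSp d)) (_ : MeasurableSet B),
    MeasurableSpace.comap (fun γ : Config d => (γ.1 ∩ B).encard) (⊤ : MeasurableSpace ℕ∞)

/-- `γ ∪ {x}`. -/
def Config.ins {d : ℕ} (γ : Config d) (x : EucSp d) : Config d :=
  ⟨insert x γ.1, fun Λ hΛ => ((γ.2 Λ hΛ).insert x).subset fun y hy => by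
    rcases hy with ⟨h1, h2⟩
    rcases h1 with rfl | h1
    · exact Set.mem_insert _ _
    · exact Set.mem_insert_of_mem _ ⟨h1, h2⟩⟩

/-- `γ ∖ {x}`. -/
def Config.del {d : ℕ} (γ : Config d) (x : EucSp d) : Config d :=
  ⟨γ.1 \ {x}, fun Λ hΛ => (γ.2 Λ hΛ).subset fun y hy => ⟨hy.1.1, hy.2⟩⟩

/-- The pairing `⟨f, γ⟩ = ∑_{x ∈ γ} f x`. -/
def cpair {d : ℕ} (f : EucSp d → ℝ) (γ : Config d) : ℝ := ∑' x : γ.1, f x.1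

/-- `exp : [-∞,∞] → [0,∞]`. -/
def eexp (x : EReal) : ℝ≥0∞ :=
  if x = ⊤ then ⊤ else if x = ⊥ then 0 else ENNReal.ofReal (Real.exp x.toReal)

/-- real-valued exponential of an extended real (with `exp(±∞)` sent to junk value `0`). -/
def rexp (x : EReal) : ℝ := (eexp x).toReal

/-- The relative energy `E(x,γ) = ∑_{y ∈ γ} φ(x-y)` if absolutely convergent, `+∞` otherwise. -/
def energy {d : ℕ} (φ : EucSp d → EReal) (x : EucSp d) (γ : Set (EucSp d)) : EReal :=
  if (∀ y ∈ γ, φ (x - y) ≠ ⊤) ∧ Summable (fun y : γ => (φ (x - y.1)).toReal)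
  then (((∑' y : γ, (φ (x - y.1)).toReal) : ℝ) : EReal)
  else ⊤

/-- `∑_{u ∈ γ} φ(u)` if absolutely convergent, `+∞` otherwise. -/
def totPhi {d : ℕ} (φ : EucSp d → EReal) (γ : Set (EucSp d)) : EReal :=
  if (∀ y ∈ γ, φ y ≠ ⊤) ∧ Summable (fun y : γ => (φ y.1).toReal)
  then (((∑' y : γ, (φ y.1).toReal) : ℝ) : EReal)
  else ⊤

/-- A pair potential: Borel, even, with `φ(x) ∈ ℝ` off the origin. -/
structure IsPairPotential {d : ℕ} (φ : EucSp d → EReal) : Prop where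
  meas : Measurable φ
  even : ∀ x : EucSp d, x ≠ 0 → φ (-x) = φ x
  finite_off : ∀ x : EucSp d, x ≠ 0 → φ x ≠ ⊤
  ne_bot : ∀ x, φ x ≠ ⊥

/-- Stability (S): `∑_{{x,y} ⊆ η} φ(x-y) ≥ -B|η|` for all finite `η`
(stated with the sum over ordered pairs, which doubles both sides). -/
def Stable {d : ℕ} (φ : EucSp d → EReal) (B : ℝ) : Prop :=
  ∀ η : Finset (EucSp d),
    ((-(2 * B * η.card) : ℝ) : EReal) ≤ ∑ p ∈ η.offDiag, φ (p.1 - p.2)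

/-- Low activity–high temperature (LA-HT): `∫ |e^{-φ} - 1| z dx < (2 e^{1+2B})⁻¹`. -/
def LAHT {d : ℕ} (φ : EucSp d → EReal) (z B : ℝ) : Prop :=
  ∫⁻ x : EucSp d, ENNReal.ofReal (|rexp (-(φ x)) - 1| * z)
    < ENNReal.ofReal (2 * Real.exp (1 + 2 * B))⁻¹

/-- The Georgii–Nguyen–Zessin identity characterizing `μ ∈ G(z,φ)`. -/
def GNZ {d : ℕ} (z : ℝ) (φ : EucSp d → EReal) (μ : Measure (Config d)) : Prop :=
  ∀ F : Config d → EucSp d → ℝ≥0∞,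
    Measurable (Function.uncurry F) →
    ∫⁻ γ, ∑' x : γ.1, F γ x.1 ∂μ
      = ∫⁻ γ, ∫⁻ x, ENNReal.ofReal z * eexp (-(energy φ x γ.1)) * F (γ.ins x) x ∂volume ∂μ


/-- Ordered `n`-tuples of distinct points of `γ`. -/
def injTuples {d : ℕ} (n : ℕ) (γ : Set (EucSp d)) : Set (Fin n → EucSp d) :=
  {p | Function.Injective p ∧ ∀ i, p i ∈ γ}

/-- `(k_μ^{(n)})` is the family of correlation functions of `μ`: each `k n` is measurable,
nonnegative and symmetric, and for every measurable symmetric `f : (ℝ^d)^n → [0,∞]`,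
`∫_Γ ∑_{{x_1,…,x_n} ⊆ γ} f dμ = (1/n!) ∫ f·kₙ dx` (stated equivalently via the sum over
ordered tuples of distinct points, which absorbs the factor `1/n!`). -/
def HasCorrFns {d : ℕ} (μ : Measure (Config d)) (k : ∀ n : ℕ, (Fin n → EucSp d) → ℝ) : Prop :=
  (∀ n : ℕ, Measurable (k n) ∧ (∀ x, 0 ≤ k n x) ∧
      ∀ (σ : Equiv.Perm (Fin n)) (x : Fin n → EucSp d), k n (x ∘ σ) = k n x) ∧
  ∀ n : ℕ, 0 < n → ∀ f : (Fin n → EucSp d) → ℝ≥0∞, Measurable f →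
    (∀ (σ : Equiv.Perm (Fin n)) (x : Fin n → EucSp d), f (x ∘ σ) = f x) →
    ∫⁻ γ, ∑' p : injTuples n γ.1, f p.1 ∂μ
      = ∫⁻ x : Fin n → EucSp d, f x * ENNReal.ofReal (k n x)

/-- The Ruelle bound `k^{(n)} ≤ ξⁿ`. -/
def RuelleBound {d : ℕ} (k : ∀ n : ℕ, (Fin n → EucSp d) → ℝ) (ξ : ℝ) : Prop :=
  ∀ n : ℕ, 0 < n → ∀ x : Fin n → EucSp d, k n x ≤ ξ ^ n

/-- Translation invariance of a family of functions on tuples. -/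
def TransInvFns {d : ℕ} (k : ∀ n : ℕ, (Fin n → EucSp d) → ℝ) : Prop :=
  ∀ (n : ℕ) (a : EucSp d) (x : Fin n → EucSp d), k n (fun i => x i + a) = k n x

/-- `P` is a partition of `{0,…,n-1}` into nonempty pairwise disjoint blocks. -/
def IsPartOfUniv {n : ℕ} (P : Finset (Finset (Fin n))) : Prop :=
  (∀ b ∈ P, b.Nonempty) ∧ (P : Set (Finset (Fin n))).PairwiseDisjoint id ∧
    P.sup id = Finset.univ

/-- `u` is the family of Ursell functions of `k`:
`k(η) = ∑ u(η_1) ⋯ u(η_j)`, summing over all partitions of `η`. -/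
def IsUrsell {d : ℕ} (k u : ∀ n : ℕ, (Fin n → EucSp d) → ℝ) : Prop :=
  ∀ n : ℕ, 0 < n → ∀ x : Fin n → EucSp d,
    k n x = ∑ P : Finset (Finset (Fin n)),
      if IsPartOfUniv P then ∏ b ∈ P, u b.card (fun i => x (b.orderIsoOfFin rfl i).1) else 0

/-- `f ∈ C_0(ℝ^d)`: continuous with compact support. -/
def IsC0 {d : ℕ} (f : EucSp d → ℝ) : Prop := Continuous f ∧ HasCompactSupport f

/-- Cylinder functions `FC_b(C_0(ℝ^d),Γ)`. -/
def Cyl {d : ℕ} (F : Config d → ℝ) : Prop :=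
  ∃ (N : ℕ) (f : Fin N → EucSp d → ℝ) (g : (Fin N → ℝ) → ℝ),
    (∀ i, IsC0 (f i)) ∧ Continuous g ∧ (∃ C, ∀ y, |g y| ≤ C) ∧
    ∀ γ, F γ = g fun i => cpair (f i) γ

/-- `(D_x^- F)(γ) = F(γ∖x) - F(γ)`. -/
def Dminus {d : ℕ} (F : Config d → ℝ) (x : EucSp d) (γ : Config d) : ℝ := F (γ.del x) - F γ

/-- `(D_x^+ F)(γ) = F(γ∪x) - F(γ)`. -/
def Dplus {d : ℕ} (F : Config d → ℝ) (x : EucSp d) (γ : Config d) : ℝ := F (γ.ins x) - F γ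

/-- `(D_{xy}^{-+} F)(γ) = F(γ∖x∪y) - F(γ)`. -/
def Dpm {d : ℕ} (F : Config d → ℝ) (x y : EucSp d) (γ : Config d) : ℝ :=
  F ((γ.del x).ins y) - F γ

/-- The Glauber bilinear form `E_G`. -/
def glauberForm {d : ℕ} (s : ℝ) (φ : EucSp d → EReal) (μ : Measure (Config d))
    (F G : Config d → ℝ) : ℝ :=
  ∫ γ, (∑' x : γ.1,
      rexp ((s : EReal) * energy φ x.1 (γ.1 \ {x.1})) * Dminus F x.1 γ * Dminus G x.1 γ) ∂μ

/-- The Kawasaki bilinear form `E_K`. -/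
def kawasakiForm {d : ℕ} (s : ℝ) (a : EucSp d → ℝ) (φ : EucSp d → EReal)
    (μ : Measure (Config d)) (F G : Config d → ℝ) : ℝ :=
  (1 / 2) * ∫ γ, (∑' x : γ.1, ∫ y : EucSp d,
      a (x.1 - y) *
        rexp ((s : EReal) * energy φ x.1 (γ.1 \ {x.1}) +
          ((s - 1 : ℝ) : EReal) * energy φ y (γ.1 \ {x.1})) *
        Dpm F x.1 y γ * Dpm G x.1 y γ) ∂μ

/-- The Glauber generator `H_G`. -/
def HG {d : ℕ} (s z : ℝ) (φ : EucSp d → EReal) (F : Config d → ℝ) (γ : Config d) : ℝ :=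
  -(∑' x : γ.1, rexp ((s : EReal) * energy φ x.1 (γ.1 \ {x.1})) * Dminus F x.1 γ)
    - ∫ x : EucSp d, z * rexp (((s - 1 : ℝ) : EReal) * energy φ x γ.1) * Dplus F x γ

/-- The Kawasaki generator `H_K`. -/
def HK {d : ℕ} (s : ℝ) (a : EucSp d → ℝ) (φ : EucSp d → EReal) (F : Config d → ℝ)
    (γ : Config d) : ℝ :=
  -(∑' x : γ.1, ∫ y : EucSp d,
      a (x.1 - y) * rexp ((s : EReal) * energy φ x.1 (γ.1 \ {x.1}) +
        ((s - 1 : ℝ) : EReal) * energy φ y (γ.1 \ {x.1})) * Dpm F x.1 y γ)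

/-- The scaled jump kernel `a_ε(x) = ε^d a(ε x)`. -/
def aScaled {d : ℕ} (a : EucSp d → ℝ) (ε : ℝ) (x : EucSp d) : ℝ := ε ^ d * a (ε • x)

/-- `H_ε^-` (death part of the Kawasaki generator with kernel `aa`). -/
def HepsMinus {d : ℕ} (s : ℝ) (aa : EucSp d → ℝ) (φ : EucSp d → EReal)
    (F : Config d → ℝ) (γ : Config d) : ℝ :=
  -(∑' x : γ.1, Dminus F x.1 γ * ∫ y : EucSp d,
      aa (x.1 - y) * rexp ((s : EReal) * energy φ x.1 (γ.1 \ {x.1}) +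
        ((s - 1 : ℝ) : EReal) * energy φ y (γ.1 \ {x.1})))

/-- `H_ε^+` (birth part of the Kawasaki generator with kernel `aa`). -/
def HepsPlus {d : ℕ} (s : ℝ) (aa : EucSp d → ℝ) (φ : EucSp d → EReal)
    (F : Config d → ℝ) (γ : Config d) : ℝ :=
  -(∑' x : γ.1, ∫ y : EucSp d,
      aa (x.1 - y) * rexp ((s : EReal) * energy φ x.1 (γ.1 \ {x.1}) +
        ((s - 1 : ℝ) : EReal) * energy φ y (γ.1 \ {x.1})) * Dplus F y (γ.del x.1))

/-- `H_0^-` (death part of the Glauber generator). -/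
def H0Minus {d : ℕ} (s : ℝ) (φ : EucSp d → EReal) (F : Config d → ℝ) (γ : Config d) : ℝ :=
  -(∑' x : γ.1, rexp ((s : EReal) * energy φ x.1 (γ.1 \ {x.1})) * Dminus F x.1 γ)

/-- `H_0^+` (birth part of the Glauber generator). -/
def H0Plus {d : ℕ} (s z : ℝ) (φ : EucSp d → EReal) (F : Config d → ℝ) (γ : Config d) : ℝ :=
  -∫ x : EucSp d, z * rexp (((s - 1 : ℝ) : EReal) * energy φ x γ.1) * Dplus F x γ

/-- The standing assumptions of the paper: `s ∈ [0,1/2]`, a stable pair potential in the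
low activity–high temperature regime, bounded outside a ball, and `μ` the Gibbs measure
from Ruelle's theorem with its correlation and Ursell functions. -/
structure Setting (d : ℕ) (s z B ξ : ℝ) (φ : EucSp d → EReal) (μ : Measure (Config d))
    (k u : ∀ n : ℕ, (Fin n → EucSp d) → ℝ) : Prop where
  hd : 0 < d
  hs0 : 0 ≤ s
  hs1 : s ≤ 1 / 2
  pp : IsPairPotential φ
  hB : 0 ≤ B
  stable : Stable φ B
  hz : 0 < z
  laht : LAHT φ z B
  bddOutside : ∃ R C : ℝ, ∀ x : EucSp d, R ≤ ‖x‖ → ∃ r : ℝ, φ x = (r : EReal) ∧ |r| ≤ C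
  prob : IsProbabilityMeasure μ
  gnz : GNZ z φ μ
  corr : HasCorrFns μ k
  ti : TransInvFns k
  hξ : 0 < ξ
  ruelle : RuelleBound k ξ
  ursell : IsUrsell k u
  ursellInt : ∀ m : ℕ,
    Integrable (fun y : Fin (m + 1) → EucSp d => u (m + 2) (Fin.cons 0 y)) volume

/-- The jump kernel `a`: bounded, nonnegative, even, integrable. -/
structure GoodA {d : ℕ} (a : EucSp d → ℝ) : Prop where
  meas : Measurable a
  nonneg : ∀ x, 0 ≤ a x
  bdd : ∃ C, ∀ x, a x ≤ C
  even : ∀ x, a (-x) = a x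
  int : Integrable a volume

/-- `φ(x) → 0` as `|x| → ∞`. -/
def PhiVanishes {d : ℕ} (φ : EucSp d → EReal) : Prop :=
  Tendsto φ (cocompact (EucSp d)) (nhds (0 : EReal))

/-- The normalization `∫ a dx = (∫_Γ exp[(s-1) ∑_{u∈γ} φ(u)] dμ(γ))⁻¹`. -/
def NormalizedA {d : ℕ} (s : ℝ) (a : EucSp d → ℝ) (φ : EucSp d → EReal)
    (μ : Measure (Config d)) : Prop :=
  (∫ x : EucSp d, a x) = (∫ γ, rexp (((s - 1 : ℝ) : EReal) * totPhi φ γ.1) ∂μ)⁻¹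


theorem measurable_congr_fun {α β : Type*} [MeasurableSpace α] [MeasurableSpace β] {f g : α → β}
    (hf : Measurable f) (h : ∀ a, f a = g a) : Measurable g :=
  funext h ▸ hf

theorem Set.encard_inter_eq_tsum {α : Type*} (s B : Set α) :
    ((s ∩ B).encard : ℝ≥0∞) = ∑' x : s, B.indicator (fun _ => (1 : ℝ≥0∞)) x.1 := by
  rw [← ENNReal.tsum_set_one, tsum_subtype (s ∩ B) fun _ => (1 : ℝ≥0∞),
    tsum_subtype s (B.indicator fun _ => (1 : ℝ≥0∞)), ← Set.indicator_indicator]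

theorem Config.countable {d : ℕ} (γ : Config d) : γ.1.Countable := by
  have h : γ.1 = ⋃ n : ℕ, γ.1 ∩ Metric.closedBall 0 n := by
    rw [← Set.inter_iUnion, Metric.iUnion_closedBall_nat, Set.inter_univ]
  rw [h]
  exact Set.countable_iUnion fun n => (γ.2 _ (isCompact_closedBall _ _)).countable

theorem Config.measurable_encard {d : ℕ} {B : Set (EucSp d)} (hB : MeasurableSet B) :
    Measurable fun γ : Config d => ((γ.1 ∩ B).encard : ℝ≥0∞) := by
  have h1 : Measurable[Config.instMS d, ⊤] fun γ : Config d => (γ.1 ∩ B).encard := by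
    rw [measurable_iff_comap_le]
    exact le_iSup₂_of_le B hB le_rfl
  exact (@measurable_from_top ℕ∞ ℝ≥0∞ _ fun m => (m : ℝ≥0∞)).comp h1

/-- A map into `Γ` is measurable if all its counting maps are. -/
theorem Config.measurable_of_encard {d : ℕ} {α : Type*} [MeasurableSpace α] {c : α → Config d}
    (h : ∀ B, MeasurableSet B → Measurable fun a => (((c a).1 ∩ B).encard : ℝ≥0∞)) :
    Measurable c := by
  rw [measurable_iff_comap_le, Config.instMS]
  simp only [MeasurableSpace.comap_iSup, iSup_le_iff]
  intro B hB
  rw [MeasurableSpace.comap_comp, ← measurable_iff_comap_le]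
  refine @measurable_to_countable' ℕ∞ α ⊤ _ _ _ fun m => ?_
  convert h B hB (measurableSet_singleton (m : ℝ≥0∞)) using 1
  ext a
  simp

/-- The counting measure of a configuration, as a kernel. -/
def Config.kernel (d : ℕ) : ProbabilityTheory.Kernel (Config d) (EucSp d) where
  toFun γ := Measure.sum fun x : γ.1 => Measure.dirac x.1
  measurable' := by
    refine Measure.measurable_of_measurable_coe _ fun B hB => ?_
    convert Config.measurable_encard hB using 2 with γ
    rw [Measure.sum_apply _ hB, Set.encard_inter_eq_tsum]
    exact tsum_congr fun x => Measure.dirac_apply' _ hB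

theorem Config.kernel_apply {d : ℕ} (γ : Config d) {B : Set (EucSp d)} (hB : MeasurableSet B) :
    Config.kernel d γ B = (γ.1 ∩ B).encard := by
  change Measure.sum (fun x : γ.1 => Measure.dirac x.1) B = _
  rw [Measure.sum_apply _ hB, Set.encard_inter_eq_tsum]
  exact tsum_congr fun x => Measure.dirac_apply' _ hB

theorem Config.lintegral_kernel {d : ℕ} (γ : Config d) (f : EucSp d → ℝ≥0∞) :
    ∫⁻ x, f x ∂(Config.kernel d γ) = ∑' x : γ.1, f x.1 := by
  change ∫⁻ x, f x ∂(Measure.sum fun x : γ.1 => Measure.dirac x.1) = _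
  simp

instance Config.isSFiniteKernel_kernel (d : ℕ) :
    ProbabilityTheory.IsSFiniteKernel (Config.kernel d) := by
  let A : ℕ → Set (EucSp d) := disjointed fun n => Metric.closedBall 0 n
  have hA : ∀ n, MeasurableSet (A n) :=
    MeasurableSet.disjointed fun n => Metric.isClosed_closedBall.measurableSet
  have hAU : ⋃ n, A n = Set.univ := by
    rw [iUnion_disjointed, Metric.iUnion_closedBall_nat]
  have hAf : ∀ (γ : Config d) n, (γ.1 ∩ A n).Finite := fun γ n =>
    (γ.2 _ (isCompact_closedBall 0 (n : ℝ))).subset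
      (Set.inter_subset_inter_right _ (disjointed_subset _ n))
  have hS : ∀ n m : ℕ, MeasurableSet {γ : Config d | ((γ.1 ∩ A n).encard : ℝ≥0∞) = (m : ℝ≥0∞)} :=
    fun n m => Config.measurable_encard (hA n) (measurableSet_singleton _)
  let κ : ℕ × ℕ → ProbabilityTheory.Kernel (Config d) (EucSp d) := fun p =>
    ProbabilityTheory.Kernel.piecewise (hS p.1 p.2) ((Config.kernel d).restrict (hA p.1)) 0
  have hκ : ∀ p, ProbabilityTheory.IsFiniteKernel (κ p) := fun p => by
    refine ⟨⟨(p.2 : ℝ≥0∞), ENNReal.natCast_lt_top _, fun γ => ?_⟩⟩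
    simp only [κ, ProbabilityTheory.Kernel.piecewise_apply, Set.mem_ofPred_eq]
    split_ifs with h
    · rw [ProbabilityTheory.Kernel.restrict_apply, Measure.restrict_apply_univ,
        Config.kernel_apply γ (hA p.1), h]
    · simp
  have hsum : Config.kernel d = ProbabilityTheory.Kernel.sum κ := by
    refine ProbabilityTheory.Kernel.ext_iff'.2 fun γ B hB => ?_
    rw [ProbabilityTheory.Kernel.sum_apply' _ _ hB, ENNReal.tsum_prod']
    have h1 : ∀ n, ∑' m, κ (n, m) γ B = Config.kernel d γ (B ∩ A n) := fun n => by
      have h2 : ((γ.1 ∩ A n).encard : ℝ≥0∞) = ((γ.1 ∩ A n).ncard : ℝ≥0∞) := by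
        rw [← (hAf γ n).cast_ncard_eq]; simp
      rw [tsum_eq_single (γ.1 ∩ A n).ncard]
      · simp only [κ, ProbabilityTheory.Kernel.piecewise_apply, Set.mem_ofPred_eq, if_pos h2,
          ProbabilityTheory.Kernel.restrict_apply' _ _ _ hB]
      · intro m hm
        have : ¬ (((γ.1 ∩ A n).encard : ℝ≥0∞) = (m : ℝ≥0∞)) := by
          rw [h2]; exact_mod_cast hm.symm
        simp only [κ, ProbabilityTheory.Kernel.piecewise_apply, Set.mem_ofPred_eq, if_neg this]
        simp
    simp_rw [h1]
    rw [← measure_iUnion, ← Set.inter_iUnion, hAU, Set.inter_univ]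
    · exact fun i j hij => ((disjoint_disjointed _) hij).mono Set.inter_subset_right
        Set.inter_subset_right
    · exact fun n => hB.inter (hA n)
  rw [hsum]
  exact ProbabilityTheory.Kernel.isSFiniteKernel_sum (hκs := fun p => inferInstance)

theorem Config.measurable_tsum {d : ℕ} {α : Type*} [MeasurableSpace α] {c : α → Config d}
    (hc : Measurable c) {f : α → EucSp d → ℝ≥0∞} (hf : Measurable (Function.uncurry f)) :
    Measurable fun a => ∑' x : (c a).1, f a x.1 := by
  have := Measurable.lintegral_kernel_prod_right (κ := (Config.kernel d).comap c hc) hf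
  simpa only [ProbabilityTheory.Kernel.comap_apply, Config.lintegral_kernel] using this

theorem Config.measurable_del {d : ℕ} :
    Measurable fun p : Config d × EucSp d => p.1.del p.2 := by
  refine Config.measurable_of_encard fun B hB => ?_
  have hf : Measurable (Function.uncurry fun (p : Config d × EucSp d) (y : EucSp d) =>
      (B \ {p.2}).indicator (fun _ => (1 : ℝ≥0∞)) y) := by
    have h : MeasurableSet {q : (Config d × EucSp d) × EucSp d | q.2 ∈ B ∧ ¬ q.2 = q.1.2} :=
      (measurable_snd hB).inter
        (measurableSet_eq_fun measurable_snd (measurable_snd.comp measurable_fst)).compl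
    exact (measurable_const (a := (1 : ℝ≥0∞))).indicator h
  convert Config.measurable_tsum measurable_fst hf using 2 with p
  rw [← Set.encard_inter_eq_tsum, ← Set.inter_sdiff_assoc, ← Set.sdiff_inter_right_comm]
  rfl

theorem summable_iff_tsum_enorm_ne_top {ι : Type*} {f : ι → ℝ} :
    Summable f ↔ ∑' i, ‖f i‖ₑ ≠ ⊤ := by
  rw [← summable_norm_iff]
  exact (NNReal.summable_coe (f := fun i => ‖f i‖₊)).trans
    ENNReal.tsum_coe_ne_top_iff_summable.symm

theorem Config.measurableSet_summable {d : ℕ} {α : Type*} [MeasurableSpace α] {c : α → Config d}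
    (hc : Measurable c) {f : α → EucSp d → ℝ} (hf : Measurable (Function.uncurry f)) :
    MeasurableSet {a | Summable fun x : (c a).1 => f a x.1} := by
  simp_rw [summable_iff_tsum_enorm_ne_top]
  exact (Config.measurable_tsum hc (f := fun a x => ‖f a x‖ₑ) hf.enorm)
    (measurableSet_singleton ⊤).compl

theorem tsum_eq_toReal_sub_toReal {ι : Type*} {f : ι → ℝ} (hf : Summable f) :
    ∑' i, f i = (∑' i, ENNReal.ofReal (f i)).toReal - (∑' i, ENNReal.ofReal (-f i)).toReal := by
  have hpos : ∀ g : ι → ℝ, (∑' i, ENNReal.ofReal (g i)).toReal = ∑' i, max (g i) 0 := fun g => by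
    rw [ENNReal.tsum_toReal_eq fun i => ENNReal.ofReal_ne_top]
    simp only [ENNReal.toReal_ofReal']
  have hs : ∀ g : ι → ℝ, Summable g → Summable fun i => max (g i) 0 := fun g hg =>
    Summable.of_nonneg_of_le (fun i => le_max_right _ _)
      (fun i => max_le (le_abs_self _) (abs_nonneg _)) hg.abs
  rw [hpos f, hpos fun i => -f i, ← (hs f hf).tsum_sub (hs _ hf.neg)]
  refine tsum_congr fun i => ?_
  rcases le_total (f i) 0 with h | h
  · rw [max_eq_right h, max_eq_left (by linarith)]; ring
  · rw [max_eq_left h, max_eq_right (by linarith)]; ring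

theorem Config.measurable_tsum_real {d : ℕ} {α : Type*} [MeasurableSpace α] {c : α → Config d}
    (hc : Measurable c) {f : α → EucSp d → ℝ} (hf : Measurable (Function.uncurry f)) :
    Measurable fun a => ∑' x : (c a).1, f a x.1 := by
  have h1 := (Config.measurable_tsum hc (f := fun a x => ENNReal.ofReal (f a x))
    hf.ennreal_ofReal).ennreal_toReal
  have h2 := (Config.measurable_tsum hc (f := fun a x => ENNReal.ofReal (-f a x))
    hf.neg.ennreal_ofReal).ennreal_toReal
  refine measurable_congr_fun (@Measurable.ite _ _ _ _ _ _ _ (Classical.decPred _)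
    (Config.measurableSet_summable hc hf) (h1.sub h2)
    (measurable_const (a := (0 : ℝ)))) fun a => ?_
  by_cases h : Summable fun x : (c a).1 => f a x.1
  · exact (if_pos h).trans (tsum_eq_toReal_sub_toReal h).symm
  · exact (if_neg h).trans (tsum_eq_zero_of_not_summable h).symm

theorem eexp_coe (r : ℝ) : eexp (r : EReal) = ENNReal.ofReal (Real.exp r) := by
  simp [eexp]

theorem rexp_coe (r : ℝ) : rexp (r : EReal) = Real.exp r := by
  rw [rexp, eexp_coe, ENNReal.toReal_ofReal (Real.exp_nonneg r)]

theorem measurable_rexp_mul_energy {d : ℕ} {φ : EucSp d → EReal} (hφ : Measurable φ) (s : ℝ)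
    {α : Type*} [MeasurableSpace α] {c : α → Config d} (hc : Measurable c) {x : α → EucSp d}
    (hx : Measurable x) : Measurable fun a => rexp ((s : EReal) * energy φ (x a) (c a).1) := by
  have hsub : Measurable fun q : α × EucSp d => x q.1 - q.2 :=
    (hx.comp measurable_fst).sub measurable_snd
  have hf : Measurable (Function.uncurry fun a y => (φ (x a - y)).toReal) :=
    (hφ.comp hsub).ereal_toReal
  have hg : Measurable (Function.uncurry fun a y =>
      {q : α × EucSp d | φ (x q.1 - q.2) = ⊤}.indicator (fun _ => (1 : ℝ≥0∞)) (a, y)) :=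
    measurable_const.indicator (hφ.comp hsub (measurableSet_singleton ⊤))
  have hset : MeasurableSet {a | (∀ y ∈ (c a).1, φ (x a - y) ≠ ⊤) ∧
      Summable fun y : (c a).1 => (φ (x a - y.1)).toReal} := by
    refine MeasurableSet.inter ?_ (Config.measurableSet_summable hc hf)
    have h := Config.measurable_tsum hc hg (measurableSet_singleton 0)
    refine (congrArg MeasurableSet (Set.ext fun a => ?_)).mp h
    simp [Set.indicator]
    exact Iff.rfl
  refine measurable_congr_fun (@Measurable.ite _ _ _ _ _ _ _ (Classical.decPred _)
    hset (Real.measurable_exp.comp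
    ((Config.measurable_tsum_real hc hf).const_mul s))
    (measurable_const (a := rexp ((s : EReal) * ⊤)))) fun a => ?_
  unfold energy
  by_cases h : (∀ y ∈ (c a).1, φ (x a - y) ≠ ⊤) ∧
      Summable fun y : (c a).1 => (φ (x a - y.1)).toReal
  · refine (if_pos h).trans ?_
    rw [if_pos h, ← EReal.coe_mul, rexp_coe]
    rfl
  · refine (if_neg h).trans ?_
    simp only [if_neg h]

/-- Bounded measurable functions on `Γ` depending only on the points in a compact set. -/
structure IsLocalBdd {d : ℕ} (F : Config d → ℝ) : Prop where
  meas : Measurable F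
  bdd : ∃ C, ∀ γ, |F γ| ≤ C
  local' : ∃ K : Set (EucSp d), IsCompact K ∧ ∀ x ∉ K, ∀ γ : Config d, F (γ.del x) = F γ

theorem cpair_del {d : ℕ} {f : EucSp d → ℝ} {x : EucSp d} (hx : f x = 0) (γ : Config d) :
    cpair f (γ.del x) = cpair f γ := by
  unfold cpair
  rw [tsum_subtype (γ.del x).1 f, tsum_subtype γ.1 f]
  refine tsum_congr fun y => ?_
  by_cases h : y = x
  · subst h
    simp [Set.indicator, hx]
  · simp [Set.indicator, Config.del, h]

theorem Cyl.isLocalBdd {d : ℕ} {F : Config d → ℝ} (hF : Cyl F) : IsLocalBdd F := by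
  obtain ⟨N, f, g, hf, hg, ⟨C, hC⟩, h⟩ := hF
  obtain rfl : F = fun γ => g fun i => cpair (f i) γ := funext h
  refine ⟨?_, ⟨C, fun γ => hC _⟩, ⋃ i, tsupport (f i), isCompact_iUnion fun i => (hf i).2, ?_⟩
  · refine hg.measurable.comp (measurable_pi_lambda _ fun i => ?_)
    exact Config.measurable_tsum_real measurable_id ((hf i).1.measurable.comp measurable_snd)
  · intro x hx γ
    congr 1
    ext i
    refine cpair_del (image_eq_zero_of_notMem_tsupport fun hi => hx ?_) γ
    exact Set.mem_iUnion_of_mem i hi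

theorem IsLocalBdd.sub {d : ℕ} {F G : Config d → ℝ} (hF : IsLocalBdd F) (hG : IsLocalBdd G) :
    IsLocalBdd fun γ => F γ - G γ := by
  obtain ⟨hFm, ⟨C, hC⟩, K, hK, hFK⟩ := hF
  obtain ⟨hGm, ⟨C', hC'⟩, K', hK', hGK⟩ := hG
  refine ⟨hFm.sub hGm, ⟨C + C', fun γ => (abs_sub _ _).trans (add_le_add (hC γ) (hC' γ))⟩,
    K ∪ K', hK.union hK', fun x hx γ => ?_⟩
  simp only [Set.mem_union, not_or] at hx
  simp only [hFK x hx.1, hGK x hx.2]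

/-- The integrand of the quadratic Glauber form, with values in `[0,∞]`. -/
def glauberDensity {d : ℕ} (s : ℝ) (φ : EucSp d → EReal) (F : Config d → ℝ) (γ : Config d) :
    ℝ≥0∞ :=
  ∑' x : γ.1, ENNReal.ofReal
    (rexp ((s : EReal) * energy φ x.1 (γ.1 \ {x.1})) * Dminus F x.1 γ * Dminus F x.1 γ)

theorem measurable_glauber_weight {d : ℕ} {φ : EucSp d → EReal} (hφ : Measurable φ) (s : ℝ) :
    Measurable fun p : Config d × EucSp d =>
      rexp ((s : EReal) * energy φ p.2 (p.1.1 \ {p.2})) :=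
  measurable_rexp_mul_energy hφ s Config.measurable_del measurable_snd

theorem measurable_Dminus {d : ℕ} {F : Config d → ℝ} (hF : Measurable F) :
    Measurable fun p : Config d × EucSp d => Dminus F p.2 p.1 :=
  (hF.comp Config.measurable_del).sub (hF.comp measurable_fst)

theorem measurable_glauber_summand {d : ℕ} {φ : EucSp d → EReal} (hφ : Measurable φ) (s : ℝ)
    {F : Config d → ℝ} (hF : Measurable F) :
    Measurable (Function.uncurry fun (γ : Config d) (x : EucSp d) =>
      rexp ((s : EReal) * energy φ x (γ.1 \ {x})) * Dminus F x γ * Dminus F x γ) :=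
  ((measurable_glauber_weight hφ s).mul (measurable_Dminus hF)).mul (measurable_Dminus hF)

theorem measurable_glauberDensity {d : ℕ} {φ : EucSp d → EReal} (hφ : Measurable φ) (s : ℝ)
    {F : Config d → ℝ} (hF : Measurable F) : Measurable (glauberDensity s φ F) :=
  Config.measurable_tsum (c := fun γ : Config d => γ) measurable_id
    (f := fun γ x => ENNReal.ofReal
      (rexp ((s : EReal) * energy φ x (γ.1 \ {x})) * Dminus F x γ * Dminus F x γ))
    (measurable_glauber_summand hφ s hF).ennreal_ofReal

theorem rexp_nonneg (x : EReal) : 0 ≤ rexp x := ENNReal.toReal_nonneg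

theorem glauber_summand_nonneg {d : ℕ} (s : ℝ) (φ : EucSp d → EReal) (F : Config d → ℝ)
    (γ : Config d) (x : EucSp d) :
    0 ≤ rexp ((s : EReal) * energy φ x (γ.1 \ {x})) * Dminus F x γ * Dminus F x γ := by
  rw [mul_assoc]
  exact mul_nonneg (rexp_nonneg _) (mul_self_nonneg _)

theorem ofReal_tsum_glauber_summand {d : ℕ} (s : ℝ) (φ : EucSp d → EReal) {F : Config d → ℝ}
    (hF : IsLocalBdd F) (γ : Config d) :
    ENNReal.ofReal (∑' x : γ.1,
      rexp ((s : EReal) * energy φ x.1 (γ.1 \ {x.1})) * Dminus F x.1 γ * Dminus F x.1 γ)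
      = glauberDensity s φ F γ := by
  obtain ⟨K, hK, hFK⟩ := hF.local'
  refine ENNReal.ofReal_tsum_of_nonneg (fun x => glauber_summand_nonneg s φ F γ x.1) ?_
  refine summable_of_hasFiniteSupport (((γ.2 K hK).preimage Subtype.val_injective.injOn).subset ?_)
  intro x hx
  refine ⟨x.2, by_contra fun hxK => hx ?_⟩
  simp [Dminus, hFK x.1 hxK γ]

theorem energy_eq_coe_or_top {d : ℕ} (φ : EucSp d → EReal) (x : EucSp d) (γ : Set (EucSp d)) :
    (∃ r : ℝ, energy φ x γ = r) ∨ energy φ x γ = ⊤ := by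
  unfold energy
  split_ifs with h
  · exact Or.inl ⟨_, rfl⟩
  · exact Or.inr rfl

theorem eexp_neg_mul_rexp_le {s : ℝ} (hs0 : 0 ≤ s) (hs1 : s ≤ 1) {d : ℕ} (φ : EucSp d → EReal)
    (x : EucSp d) (γ : Set (EucSp d)) :
    eexp (-energy φ x γ) * ENNReal.ofReal (rexp ((s : EReal) * energy φ x γ))
      ≤ 1 + eexp (-energy φ x γ) := by
  rcases energy_eq_coe_or_top φ x γ with ⟨r, hr⟩ | h
  · rw [hr, ← EReal.coe_neg, ← EReal.coe_mul, eexp_coe, rexp_coe,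
      ← ENNReal.ofReal_mul (Real.exp_nonneg _), ← ENNReal.ofReal_one,
      ← ENNReal.ofReal_add zero_le_one (Real.exp_nonneg _), ← Real.exp_add]
    refine ENNReal.ofReal_le_ofReal ?_
    rcases le_total 0 r with h | h
    · have : Real.exp (-r + s * r) ≤ 1 := Real.exp_le_one_iff.2 (by nlinarith)
      linarith [Real.exp_nonneg (-r)]
    · have : Real.exp (-r + s * r) ≤ Real.exp (-r) := Real.exp_le_exp.2 (by nlinarith)
      linarith
  · rw [h]
    simp [eexp]

theorem Config.ae_notMem {d : ℕ} (hd : 0 < d) (γ : Config d) :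
    ∀ᵐ x : EucSp d, x ∉ γ.1 := by
  have : Nonempty (Fin d) := ⟨⟨0, hd⟩⟩
  exact γ.countable.ae_notMem volume

theorem Config.ins_diff {d : ℕ} {γ : Config d} {x : EucSp d} (hx : x ∉ γ.1) :
    (γ.ins x).1 \ {x} = γ.1 := by
  simp [Config.ins, hx]

theorem Config.ins_del {d : ℕ} {γ : Config d} {x : EucSp d} (hx : x ∉ γ.1) :
    (γ.ins x).del x = γ :=
  Subtype.ext (Config.ins_diff hx)

theorem tsum_injTuples_one {d : ℕ} (γ : Set (EucSp d)) (f : EucSp d → ℝ≥0∞) :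
    ∑' p : injTuples 1 γ, f (p.1 0) = ∑' x : γ, f x.1 := by
  let e : injTuples 1 γ ≃ γ :=
    { toFun := fun p => ⟨p.1 0, p.2.2 0⟩
      invFun := fun x => ⟨fun _ => x.1, Function.injective_of_subsingleton _, fun _ => x.2⟩
      left_inv := fun p => Subtype.ext (funext fun i => by rw [Subsingleton.elim i 0])
      right_inv := fun x => rfl }
  exact e.tsum_eq fun x : γ => f x.1

theorem Setting.lintegral_count_ne_top {d : ℕ} {s z B ξ : ℝ} {φ : EucSp d → EReal}
    {μ : Measure (Config d)} {k u : ∀ n : ℕ, (Fin n → EucSp d) → ℝ}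
    (hset : Setting d s z B ξ φ μ k u) {K : Set (EucSp d)} (hK : IsCompact K) :
    ∫⁻ γ, ∑' x : γ.1, K.indicator (fun _ => (1 : ℝ≥0∞)) x.1 ∂μ ≠ ⊤ := by
  have hf : Measurable fun p : Fin 1 → EucSp d => K.indicator (fun _ => (1 : ℝ≥0∞)) (p 0) :=
    (measurable_const.indicator hK.measurableSet).comp (measurable_pi_apply 0)
  have h := hset.corr.2 1 one_pos _ hf fun σ x => by rw [Subsingleton.elim σ 1]; rfl
  simp_rw [tsum_injTuples_one] at h
  rw [h]
  have hv : volume {p : Fin 1 → EucSp d | p 0 ∈ K} = volume K := by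
    have : {p : Fin 1 → EucSp d | p 0 ∈ K} = Set.univ.pi fun _ => K := by
      ext p; simp
    rw [this, volume_pi_pi]; simp
  have hm : MeasurableSet {p : Fin 1 → EucSp d | p 0 ∈ K} :=
    measurable_pi_apply 0 hK.measurableSet
  refine ne_top_of_le_ne_top (b := ENNReal.ofReal (ξ ^ 1) * volume K)
    (ENNReal.mul_ne_top ENNReal.ofReal_ne_top hK.measure_ne_top) ?_
  rw [← hv, ← lintegral_indicator_const hm]
  refine lintegral_mono fun p => ?_
  by_cases hp : p 0 ∈ K
  · simpa [Set.indicator, hp] using ENNReal.ofReal_le_ofReal (hset.ruelle 1 one_pos p)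
  · simp [Set.indicator, hp]

theorem Setting.lintegral_glauber_weight_ne_top {d : ℕ} {s z B ξ : ℝ} {φ : EucSp d → EReal}
    {μ : Measure (Config d)} {k u : ∀ n : ℕ, (Fin n → EucSp d) → ℝ}
    (hset : Setting d s z B ξ φ μ k u) {K : Set (EucSp d)} (hK : IsCompact K) :
    ∫⁻ γ, ∑' x : γ.1, ENNReal.ofReal (rexp ((s : EReal) * energy φ x.1 (γ.1 \ {x.1}))) *
      K.indicator (fun _ => (1 : ℝ≥0∞)) x.1 ∂μ ≠ ⊤ := by
  have := hset.prob
  have hKm : Measurable (K.indicator fun _ => (1 : ℝ≥0∞)) :=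
    measurable_const.indicator hK.measurableSet
  rw [hset.gnz (fun γ x => ENNReal.ofReal (rexp ((s : EReal) * energy φ x (γ.1 \ {x}))) *
      K.indicator (fun _ => (1 : ℝ≥0∞)) x)
    ((measurable_glauber_weight hset.pp.meas s).ennreal_ofReal.mul (hKm.comp measurable_snd))]
  have hc := hset.lintegral_count_ne_top hK
  rw [hset.gnz (fun _ x => K.indicator (fun _ => (1 : ℝ≥0∞)) x) (hKm.comp measurable_snd)] at hc
  have hle : ∀ γ : Config d,
      ∫⁻ x, ENNReal.ofReal z * eexp (-(energy φ x γ.1)) *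
        (ENNReal.ofReal (rexp ((s : EReal) * energy φ x ((γ.ins x).1 \ {x}))) *
          K.indicator (fun _ => (1 : ℝ≥0∞)) x) ≤
      ENNReal.ofReal z * volume K +
        ∫⁻ x, ENNReal.ofReal z * eexp (-(energy φ x γ.1)) *
          K.indicator (fun _ => (1 : ℝ≥0∞)) x := fun γ => by
    rw [← lintegral_indicator_const hK.measurableSet,
      ← lintegral_add_left (measurable_const.indicator hK.measurableSet)]
    refine lintegral_mono_ae ?_
    filter_upwards [γ.ae_notMem hset.hd] with x hx
    rw [Config.ins_diff hx]
    by_cases hxK : x ∈ K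
    · simp only [Set.indicator_of_mem hxK, mul_one, mul_assoc]
      calc _ ≤ ENNReal.ofReal z * (1 + eexp (-energy φ x γ.1)) :=
            mul_le_mul_right (eexp_neg_mul_rexp_le hset.hs0 (by linarith [hset.hs1]) φ x γ.1) _
        _ = _ := by rw [mul_add, mul_one]
    · simp [hxK]
  refine ne_top_of_le_ne_top ?_ (lintegral_mono hle)
  rw [lintegral_add_left measurable_const, lintegral_const, measure_univ, mul_one]
  exact ENNReal.add_ne_top.2 ⟨ENNReal.mul_ne_top ENNReal.ofReal_ne_top hK.measure_ne_top, hc⟩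

theorem Setting.lintegral_glauberDensity_ne_top {d : ℕ} {s z B ξ : ℝ} {φ : EucSp d → EReal}
    {μ : Measure (Config d)} {k u : ∀ n : ℕ, (Fin n → EucSp d) → ℝ}
    (hset : Setting d s z B ξ φ μ k u) {F : Config d → ℝ} (hF : IsLocalBdd F) :
    ∫⁻ γ, glauberDensity s φ F γ ∂μ ≠ ⊤ := by
  obtain ⟨K, hK, hFK⟩ := hF.local'
  obtain ⟨C, hC⟩ := hF.bdd
  have hle : ∀ γ : Config d, glauberDensity s φ F γ ≤ ENNReal.ofReal ((2 * C) ^ 2) *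
      ∑' x : γ.1, ENNReal.ofReal (rexp ((s : EReal) * energy φ x.1 (γ.1 \ {x.1}))) *
        K.indicator (fun _ => (1 : ℝ≥0∞)) x.1 := fun γ => by
    rw [glauberDensity, ← ENNReal.tsum_mul_left]
    refine ENNReal.tsum_le_tsum fun x => ?_
    by_cases hx : x.1 ∈ K
    · rw [Set.indicator_of_mem hx, mul_one, ← ENNReal.ofReal_mul (sq_nonneg _), mul_assoc,
        mul_comm ((2 * C) ^ 2), ← sq]
      refine ENNReal.ofReal_le_ofReal (mul_le_mul_of_nonneg_left ?_ (rexp_nonneg _))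
      refine sq_le_sq' ?_ ?_ <;> unfold Dminus <;>
        linarith [abs_le.1 (hC (γ.del x.1)), abs_le.1 (hC γ)]
    · simp [Dminus, hFK x.1 hx γ]
  refine ne_top_of_le_ne_top ?_ (lintegral_mono hle)
  rw [lintegral_const_mul' _ _ ENNReal.ofReal_ne_top]
  exact ENNReal.mul_ne_top ENNReal.ofReal_ne_top (hset.lintegral_glauber_weight_ne_top hK)

theorem Setting.ofReal_glauberForm {d : ℕ} {s z B ξ : ℝ} {φ : EucSp d → EReal}
    {μ : Measure (Config d)} {k u : ∀ n : ℕ, (Fin n → EucSp d) → ℝ}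
    (hset : Setting d s z B ξ φ μ k u) {F : Config d → ℝ} (hF : IsLocalBdd F) :
    ENNReal.ofReal (glauberForm s φ μ F F) = ∫⁻ γ, glauberDensity s φ F γ ∂μ := by
  let f : Config d → ℝ := fun γ => ∑' x : γ.1,
    rexp ((s : EReal) * energy φ x.1 (γ.1 \ {x.1})) * Dminus F x.1 γ * Dminus F x.1 γ
  have hm : Measurable f := Config.measurable_tsum_real (c := fun γ : Config d => γ) measurable_id
    (f := fun γ x => rexp ((s : EReal) * energy φ x (γ.1 \ {x})) * Dminus F x γ * Dminus F x γ)
    (measurable_glauber_summand hset.pp.meas s hF.meas)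
  have hf0 : ∀ γ, 0 ≤ f γ := fun γ => tsum_nonneg fun x => glauber_summand_nonneg s φ F γ x.1
  have hlin : ∫⁻ γ, ENNReal.ofReal (f γ) ∂μ = ∫⁻ γ, glauberDensity s φ F γ ∂μ :=
    lintegral_congr fun γ => ofReal_tsum_glauber_summand s φ hF γ
  have hint : ∫ γ, f γ ∂μ = (∫⁻ γ, glauberDensity s φ F γ ∂μ).toReal := by
    rw [← hlin]
    exact integral_eq_lintegral_of_nonneg_ae (ae_of_all _ hf0) hm.aestronglyMeasurable
  change ENNReal.ofReal (∫ γ, f γ ∂μ) = _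
  rw [hint]
  exact ENNReal.ofReal_toReal (hset.lintegral_glauberDensity_ne_top hF)

theorem glauberForm_self_nonneg {d : ℕ} (s : ℝ) (φ : EucSp d → EReal) (μ : Measure (Config d))
    (F : Config d → ℝ) : 0 ≤ glauberForm s φ μ F F :=
  integral_nonneg fun γ => tsum_nonneg fun x => glauber_summand_nonneg s φ F γ x.1

/-- Almost sure properties are stable under removal of a point of the configuration. -/
theorem Setting.ae_del {d : ℕ} {s z B ξ : ℝ} {φ : EucSp d → EReal}
    {μ : Measure (Config d)} {k u : ∀ n : ℕ, (Fin n → EucSp d) → ℝ}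
    (hset : Setting d s z B ξ φ μ k u) {P : Config d → Prop} (hP : ∀ᵐ γ ∂μ, P γ) :
    ∀ᵐ γ ∂μ, ∀ x ∈ γ.1, P (γ.del x) := by
  obtain ⟨N, hPN, hNm, hN⟩ := exists_measurable_superset_of_null (ae_iff.1 hP)
  have hNi : Measurable (N.indicator fun _ => (1 : ℝ≥0∞)) := measurable_const.indicator hNm
  have hmeas : Measurable (Function.uncurry fun (γ : Config d) (x : EucSp d) =>
      N.indicator (fun _ => (1 : ℝ≥0∞)) (γ.del x)) := hNi.comp Config.measurable_del
  have h := hset.gnz (fun γ x => N.indicator (fun _ => (1 : ℝ≥0∞)) (γ.del x)) hmeas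
  have h0 : ∫⁻ γ, ∫⁻ x, ENNReal.ofReal z * eexp (-(energy φ x γ.1)) *
      N.indicator (fun _ => (1 : ℝ≥0∞)) ((γ.ins x).del x) ∂volume ∂μ = 0 := by
    refine lintegral_eq_zero_of_ae_eq_zero ?_
    filter_upwards [measure_eq_zero_iff_ae_notMem.1 hN] with γ hγ
    refine lintegral_eq_zero_of_ae_eq_zero ?_
    filter_upwards [γ.ae_notMem hset.hd] with x hx
    simp [Config.ins_del hx, hγ]
  rw [h0, lintegral_eq_zero_iff
    (Config.measurable_tsum (c := fun γ : Config d => γ) measurable_id hmeas)] at h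
  filter_upwards [h] with γ hγ x hx
  by_contra hPx
  have := ENNReal.tsum_eq_zero.1 hγ ⟨x, hx⟩
  rw [Set.indicator_of_mem (hPN hPx)] at this
  exact one_ne_zero this

theorem ENNReal.tsum_le_liminf_tsum {ι : Type*} [Countable ι] {a : ι → ℝ≥0∞}
    {b : ℕ → ι → ℝ≥0∞} (h : ∀ i, Tendsto (fun n => b n i) atTop (nhds (a i))) :
    ∑' i, a i ≤ liminf (fun n => ∑' i, b n i) atTop := by
  let : MeasurableSpace ι := ⊤
  have : DiscreteMeasurableSpace ι := ⟨fun _ => trivial⟩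
  have := lintegral_liminf_le (μ := (Measure.count : Measure ι)) (f := b) (u := atTop)
    fun n => measurable_from_top
  simpa only [lintegral_count, fun i => (h i).liminf_eq] using this

theorem glauberDensity_le_liminf {d : ℕ} (s : ℝ) (φ : EucSp d → EReal) (F : Config d → ℝ)
    {G : ℕ → Config d → ℝ} {γ : Config d} (hγ : Tendsto (fun j => G j γ) atTop (nhds 0))
    (hdel : ∀ x ∈ γ.1, Tendsto (fun j => G j (γ.del x)) atTop (nhds 0)) :
    glauberDensity s φ F γ ≤
      liminf (fun j => glauberDensity s φ (fun γ => F γ - G j γ) γ) atTop := by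
  have : Countable γ.1 := γ.countable
  refine ENNReal.tsum_le_liminf_tsum fun x => ENNReal.tendsto_ofReal ?_
  have hD : Tendsto (fun j => Dminus (fun γ => F γ - G j γ) x.1 γ) atTop
      (nhds (Dminus F x.1 γ)) := by
    simpa [Dminus] using ((hdel x.1 x.2).const_sub (F (γ.del x.1))).sub (hγ.const_sub (F γ))
  exact (hD.const_mul _).mul hD

theorem exists_subseq_ae_tendsto_zero {Ω : Type*} [MeasurableSpace Ω] {μ : Measure Ω}
    {F : ℕ → Ω → ℝ} (hint : ∀ n, Integrable (fun ω => F n ω ^ 2) μ)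
    (h : Tendsto (fun n => ∫ ω, F n ω ^ 2 ∂μ) atTop (nhds 0)) :
    ∃ ns : ℕ → ℕ, StrictMono ns ∧
      ∀ᵐ ω ∂μ, Tendsto (fun j => F (ns j) ω) atTop (nhds 0) := by
  have h1 : Tendsto (fun n => eLpNorm ((fun ω => F n ω ^ 2) - fun _ => (0 : ℝ)) 1 μ) atTop
      (nhds 0) := by
    have h2 := ENNReal.tendsto_ofReal h
    rw [ENNReal.ofReal_zero] at h2
    refine h2.congr fun n => ?_
    rw [eLpNorm_one_eq_lintegral_enorm,
      ofReal_integral_eq_lintegral_ofReal (hint n) (ae_of_all _ fun ω => sq_nonneg _)]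
    refine lintegral_congr fun ω => ?_
    simp only [Pi.sub_apply, sub_zero, Real.enorm_eq_ofReal_abs, abs_sq]
  obtain ⟨ns, hns, hae⟩ := (tendstoInMeasure_of_tendsto_eLpNorm one_ne_zero
    (fun n => (hint n).aestronglyMeasurable) aestronglyMeasurable_const h1).exists_seq_tendsto_ae
  refine ⟨ns, hns, hae.mono fun ω hω => ?_⟩
  have h3 := (Real.continuous_sqrt.tendsto 0).comp hω
  rw [Real.sqrt_zero] at h3
  refine tendsto_zero_iff_abs_tendsto_zero _ |>.2 (h3.congr fun j => ?_)
  exact Real.sqrt_sq_eq_abs _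

/-- the Glauber form `(E_G, FC_b(C_0(ℝ^d),Γ))` is closable on `L²(Γ,μ)`:
if `F_n → 0` in `L²(Γ,μ)` and `E_G(F_n - F_m, F_n - F_m) → 0` as `n,m → ∞`, then
`E_G(F_n,F_n) → 0`. -/
theorem statement5 (d : ℕ) (s z B ξ : ℝ) (φ : EucSp d → EReal) (μ : Measure (Config d))
    (k u : ∀ n : ℕ, (Fin n → EucSp d) → ℝ) (hset : Setting d s z B ξ φ μ k u)
    (F : ℕ → Config d → ℝ) (hF : ∀ n, Cyl (F n))
    (hL2 : Tendsto (fun n => ∫ γ, (F n γ) ^ 2 ∂μ) atTop (nhds 0))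
    (hCauchy : Tendsto (fun p : ℕ × ℕ =>
        glauberForm s φ μ (fun γ => F p.1 γ - F p.2 γ) (fun γ => F p.1 γ - F p.2 γ))
      atTop (nhds 0)) :
    Tendsto (fun n => glauberForm s φ μ (F n) (F n)) atTop (nhds 0) := by
  have := hset.prob
  have hloc : ∀ n, IsLocalBdd (F n) := fun n => (hF n).isLocalBdd
  have hint : ∀ n, Integrable (fun γ => F n γ ^ 2) μ := fun n => by
    obtain ⟨C, hC⟩ := (hloc n).bdd
    refine Integrable.of_bound ((hloc n).meas.pow_const 2).aestronglyMeasurable (C ^ 2)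
      (ae_of_all _ fun γ => ?_)
    rw [norm_pow, Real.norm_eq_abs]
    exact pow_le_pow_left₀ (abs_nonneg _) (hC γ) 2
  obtain ⟨ns, hns, hae⟩ := exists_subseq_ae_tendsto_zero hint hL2
  have hfatou : ∀ n, ENNReal.ofReal (glauberForm s φ μ (F n) (F n)) ≤
      liminf (fun j => ENNReal.ofReal (glauberForm s φ μ (fun γ => F n γ - F (ns j) γ)
        (fun γ => F n γ - F (ns j) γ))) atTop := fun n => by
    simp_rw [fun j => hset.ofReal_glauberForm ((hloc n).sub (hloc (ns j))),
      hset.ofReal_glauberForm (hloc n)]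
    refine le_trans (lintegral_mono_ae ?_) (lintegral_liminf_le fun j =>
      measurable_glauberDensity hset.pp.meas s ((hloc n).sub (hloc (ns j))).meas)
    filter_upwards [hae, hset.ae_del hae] with γ hγ hdel
    exact glauberDensity_le_liminf s φ (F n) hγ hdel
  refine Metric.tendsto_atTop.2 fun ε hε => ?_
  have hev := hCauchy.eventually (gt_mem_nhds (half_pos hε))
  obtain ⟨N, hN⟩ := eventually_atTop_prod_self.1 hev
  refine ⟨N, fun n hn => ?_⟩
  rw [Real.dist_eq, sub_zero, abs_of_nonneg (glauberForm_self_nonneg s φ μ (F n))]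
  refine lt_of_le_of_lt ?_ (half_lt_self hε)
  refine (ENNReal.ofReal_le_ofReal_iff (half_pos hε).le).1 ((hfatou n).trans ?_)
  refine liminf_le_of_frequently_le' (Eventually.frequently ?_)
  filter_upwards [hns.tendsto_atTop.eventually_ge_atTop N] with j hj
  exact ENNReal.ofReal_le_ofReal (hN n (ns j) hn hj).le

end
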